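/- Let n ≥ 2 be an integer, s ∈ (0,1), and let φ ∈ C_c^∞(ℝ^{n−1}; [0,1]) satisfy φ(x′) = 1 for |x′| ≤ 1/2 and φ(x′) = 0 for |x′| ≥ 3/4. For η > 0 define the subgraph F := {x = (x′, x_n) ∈ ℝⁿ : x_n < η·φ(x′)}. Then there exists C₀ > 0, depending only on n, s and φ, such that for every p ∈ ∂F the nonlocal mean curvature H_s(F, p) exists and satisfies H_s(F, p) ≤ C₀·η. -/

import Mathlib

open MeasureTheory Set Filter
open scoped ENNReal

/-- The last coordinate `x_n` of a point `x = (x', x_n) ∈ ℝⁿ`. -/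
noncomputable def lastCoord {n : ℕ} (x : EuclideanSpace ℝ (Fin n)) : ℝ :=
  if h : 0 < n then x ⟨n - 1, by omega⟩ else 0

/-- The projection `x ↦ x'` onto the first `n-1` coordinates. -/
noncomputable def projFirst {n : ℕ} (x : EuclideanSpace ℝ (Fin n)) :
    EuclideanSpace ℝ (Fin (n - 1)) :=
  (EuclideanSpace.equiv (Fin (n - 1)) ℝ).symm fun i => x (Fin.castLE (Nat.sub_le n 1) i)

/-- The truncated nonlocal mean curvature integral
`∫_{|y−p|>ε} (χ_{Fᶜ}(y) − χ_F(y)) |y−p|^{−(n+s)} dy`. -/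
noncomputable def nmcAt (n : ℕ) (s : ℝ) (F : Set (EuclideanSpace ℝ (Fin n)))
    (p : EuclideanSpace ℝ (Fin n)) (ε : ℝ) : ℝ :=
  ∫ y in {y : EuclideanSpace ℝ (Fin n) | ε < ‖y - p‖},
    (Set.indicator Fᶜ (fun _ => (1 : ℝ)) y - Set.indicator F (fun _ => (1 : ℝ)) y) *
      ‖y - p‖ ^ (-((n : ℝ) + s))

/-- The nonlocal mean curvature of `F` at `p` exists (as a principal value as `ε → 0⁺`)
and equals `h`. -/
def HasNMC (n : ℕ) (s : ℝ) (F : Set (EuclideanSpace ℝ (Fin n)))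
    (p : EuclideanSpace ℝ (Fin n)) (h : ℝ) : Prop :=
  Filter.Tendsto (nmcAt n s F p) (nhdsWithin 0 (Set.Ioi 0)) (nhds h)

lemma continuous_lastCoord {n : ℕ} : Continuous (lastCoord (n := n)) := by
  unfold lastCoord
  split_ifs <;> fun_prop

lemma continuous_projFirst {n : ℕ} : Continuous (projFirst (n := n)) := by
  unfold projFirst
  fun_prop

lemma projFirst_add {n : ℕ} (x y : EuclideanSpace ℝ (Fin n)) :
    projFirst (x + y) = projFirst x + projFirst y := by
  ext i; simp [projFirst]

lemma projFirst_neg {n : ℕ} (x : EuclideanSpace ℝ (Fin n)) :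
    projFirst (-x) = -projFirst x := by
  ext i; simp [projFirst]

lemma lastCoord_add {n : ℕ} (x y : EuclideanSpace ℝ (Fin n)) :
    lastCoord (x + y) = lastCoord x + lastCoord y := by
  unfold lastCoord; split_ifs <;> simp

lemma lastCoord_neg {n : ℕ} (x : EuclideanSpace ℝ (Fin n)) :
    lastCoord (-x) = -lastCoord x := by
  unfold lastCoord; split_ifs <;> simp

lemma norm_sq_eq_projFirst_lastCoord {n : ℕ} (x : EuclideanSpace ℝ (Fin n)) :
    ‖x‖ ^ 2 = ‖projFirst x‖ ^ 2 + lastCoord x ^ 2 := by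
  rcases n with _ | m
  · have : x = 0 := Subsingleton.elim _ _
    subst this
    simp [projFirst, lastCoord, EuclideanSpace.norm_sq_eq]
  · rw [EuclideanSpace.norm_sq_eq, EuclideanSpace.norm_sq_eq, Fin.sum_univ_castSucc]
    simp [projFirst, lastCoord]
    rfl

lemma norm_projFirst_le {n : ℕ} (x : EuclideanSpace ℝ (Fin n)) : ‖projFirst x‖ ≤ ‖x‖ := by
  have := norm_sq_eq_projFirst_lastCoord x
  exact le_of_sq_le_sq (by nlinarith [sq_nonneg (lastCoord x)]) (norm_nonneg _)

lemma measurePreserving_lastCoord_projFirst {n : ℕ} (hn : n ≠ 0) :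
    MeasurePreserving (fun x : EuclideanSpace ℝ (Fin n) => (lastCoord x, projFirst x))
      volume (volume.prod volume) := by
  obtain ⟨m, rfl⟩ := Nat.exists_eq_succ_of_ne_zero hn
  have h := (((MeasurePreserving.id (volume : Measure ℝ)).prod
    (PiLp.volume_preserving_toLp (Fin m))).comp
    (volume_preserving_piFinSuccAbove (fun _ : Fin (m + 1) => ℝ) (Fin.last m))).comp
    (PiLp.volume_preserving_ofLp (Fin (m + 1)))
  have hfun : (fun x : EuclideanSpace ℝ (Fin (m + 1)) => (lastCoord x, projFirst x)) =
      (Prod.map id (WithLp.toLp 2) ∘ MeasurableEquiv.piFinSuccAbove (fun _ => ℝ) (Fin.last m)) ∘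
        WithLp.ofLp := by
    funext x
    refine Prod.ext ?_ ?_
    · simp [lastCoord]; rfl
    · ext i
      simp [projFirst]
      rfl
  exact hfun ▸ h

lemma integrable_min_norm_mul_rpow {d : ℕ} (hd : d ≠ 0) {s : ℝ} (hs : s ∈ Ioo (0 : ℝ) 1) :
    Integrable fun x : EuclideanSpace ℝ (Fin d) =>
      min (‖x‖ ^ 2) ‖x‖ * ‖x‖ ^ (-((d : ℝ) + 1 + s)) := by
  obtain ⟨k, rfl⟩ := Nat.exists_eq_succ_of_ne_zero hd
  rw [integrable_fun_norm_addHaar volume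
    (f := fun r : ℝ => min (r ^ 2) r * r ^ (-(((k + 1 : ℕ) : ℝ) + 1 + s)))]
  rw [← Ioc_union_Ioi_eq_Ioi (zero_le_one' ℝ)]
  refine IntegrableOn.union ?_ ?_
  · have h : IntegrableOn (fun r : ℝ => r ^ (-s)) (Ioc 0 1) := by
      rw [integrableOn_Ioc_iff_integrableOn_Ioo,
        intervalIntegral.integrableOn_Ioo_rpow_iff one_pos]
      linarith [hs.2]
    refine h.congr_fun (fun r hr => ?_) measurableSet_Ioc
    have hr0 := hr.1
    simp only [finrank_euclideanSpace, Fintype.card_fin, smul_eq_mul, Nat.succ_eq_add_one,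
      Nat.add_sub_cancel]
    rw [min_eq_left (by nlinarith [hr.2]), ← mul_assoc, ← pow_add, ← Real.rpow_natCast,
      ← Real.rpow_add hr0]
    congr 1; push_cast; ring
  · have h : IntegrableOn (fun r : ℝ => r ^ (-1 - s)) (Ioi 1) :=
      integrableOn_Ioi_rpow_of_lt (by linarith [hs.1]) one_pos
    refine h.congr_fun (fun r hr => ?_) measurableSet_Ioi
    have hr1 : 1 < r := hr
    have hr0 : 0 < r := by linarith
    simp only [finrank_euclideanSpace, Fintype.card_fin, smul_eq_mul, Nat.succ_eq_add_one,
      Nat.add_sub_cancel]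
    rw [min_eq_right (by nlinarith), ← mul_assoc, ← pow_succ, ← Real.rpow_natCast,
      ← Real.rpow_add hr0]
    congr 1; push_cast; ring

lemma integrable_indicator_norm_rpow {d : ℕ} (hd : d ≠ 0) {s : ℝ} (hs : 0 < s)
    {ε : ℝ} (hε : 0 < ε) :
    Integrable ({x : EuclideanSpace ℝ (Fin d) | ε < ‖x‖}.indicator
      fun x => ‖x‖ ^ (-((d : ℝ) + s))) := by
  obtain ⟨k, rfl⟩ := Nat.exists_eq_succ_of_ne_zero hd
  have := (integrable_fun_norm_addHaar (volume : Measure (EuclideanSpace ℝ (Fin (k + 1))))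
    (f := (Ioi ε).indicator fun r : ℝ => r ^ (-(((k + 1 : ℕ) : ℝ) + s)))).2 ?_
  · exact this
  · have h : IntegrableOn (fun r : ℝ => r ^ (-1 - s)) (Ioi ε) :=
      integrableOn_Ioi_rpow_of_lt (by linarith) hε
    have h' := (h.integrable_indicator measurableSet_Ioi).integrableOn (s := Ioi 0)
    refine h'.congr_fun (fun r hr => ?_) measurableSet_Ioi
    have hr0 : 0 < r := hr
    by_cases hrε : r ∈ Ioi ε
    · simp only [finrank_euclideanSpace, Fintype.card_fin, smul_eq_mul, Nat.add_sub_cancel,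
        indicator_of_mem hrε]
      rw [← Real.rpow_natCast, ← Real.rpow_add hr0]
      congr 1; push_cast; ring
    · simp [indicator_of_notMem hrε]

lemma exists_norm_taylor_remainder_le {E : Type*} [NormedAddCommGroup E] [NormedSpace ℝ E]
    {φ : E → ℝ} (hφ : ContDiff ℝ 2 φ) (hsupp : HasCompactSupport φ) :
    ∃ K : ℝ, 0 ≤ K ∧ ∀ x t : E,
      |φ (x + t) - φ x - fderiv ℝ φ x t| ≤ K * min (‖t‖ ^ 2) ‖t‖ := by
  obtain ⟨A, hA⟩ := hφ.lipschitzWith_of_hasCompactSupport hsupp (by simp)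
  have hφ' : ContDiff ℝ 1 (fderiv ℝ φ) := hφ.fderiv_right (by norm_num)
  obtain ⟨B, hB⟩ := hφ'.lipschitzWith_of_hasCompactSupport (hsupp.fderiv ℝ) (by simp)
  have hdiff : Differentiable ℝ φ := hφ.differentiable (by simp)
  have hK : 0 ≤ max (2 * (A : ℝ)) (B : ℝ) := le_max_of_le_right B.2
  refine ⟨max (2 * A) B, hK, fun x t => ?_⟩
  rw [mul_min_of_nonneg _ _ hK, le_min_iff]
  constructor
  · have h := (convex_closedBall x ‖t‖).norm_image_sub_le_of_norm_hasFDerivWithin_le'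
      (f := φ) (f' := fderiv ℝ φ) (φ := fderiv ℝ φ x) (C := B * ‖t‖) (x := x) (y := x + t)
      (fun z _ => (hdiff z).hasFDerivAt.hasFDerivWithinAt)
      (fun z hz => (hB.norm_sub_le z x).trans (by
        gcongr; simpa [dist_eq_norm] using hz))
      (by simp) (by simp)
    rw [add_sub_cancel_left, Real.norm_eq_abs] at h
    refine h.trans ?_
    rw [mul_assoc, ← sq]
    gcongr
    exact le_max_right _ _
  · have h1 : |φ (x + t) - φ x| ≤ A * ‖t‖ := by
      simpa using hA.norm_sub_le (x + t) x
    have h2 : |fderiv ℝ φ x t| ≤ A * ‖t‖ :=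
      (fderiv ℝ φ x).le_of_opNorm_le (norm_fderiv_le_of_lipschitz ℝ hA) t
    calc _ ≤ A * ‖t‖ + A * ‖t‖ := (abs_sub _ _).trans (add_le_add h1 h2)
      _ = 2 * A * ‖t‖ := by ring
      _ ≤ _ := by gcongr; exact le_max_left _ _

lemma abs_ite_sub_sign_le (a b τ : ℝ) :
    |(if τ < a then -1 else 1) - Real.sign (τ - b)| ≤ (uIcc a b).indicator (fun _ => 2) τ := by
  by_cases hτ : τ ∈ uIcc a b
  · rw [indicator_of_mem hτ]
    rcases Real.sign_apply_eq (τ - b) with h | h | h <;> rw [h] <;> split_ifs <;> norm_num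
  · rw [indicator_of_notMem hτ]
    rw [mem_uIcc, not_or, not_and_or, not_and_or, not_le, not_le, not_le, not_le] at hτ
    obtain ⟨h₁ | h₁, h₂ | h₂⟩ := hτ
    · rw [if_pos h₁, Real.sign_of_neg (by linarith)]; norm_num
    · rw [if_pos h₁, Real.sign_of_neg (by linarith)]; norm_num
    · rw [if_neg (by linarith), Real.sign_of_pos (by linarith)]; norm_num
    · rw [if_neg (by linarith), Real.sign_of_pos (by linarith)]; norm_num

lemma measurable_indicator_uIcc {α : Type*} [MeasurableSpace α] {a b w τ : α → ℝ}
    (ha : Measurable a) (hb : Measurable b) (hw : Measurable w) (hτ : Measurable τ) :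
    Measurable fun z => (uIcc (a z) (b z)).indicator (fun _ => w z) (τ z) := by
  have hS : MeasurableSet {z | τ z ∈ uIcc (a z) (b z)} :=
    (measurableSet_le (ha.min hb) hτ).inter (measurableSet_le hτ (ha.max hb))
  exact hw.indicator hS

lemma lintegral_indicator_uIcc {n : ℕ} (hn : n ≠ 0)
    {a b w : EuclideanSpace ℝ (Fin (n - 1)) → ℝ}
    (ha : Measurable a) (hb : Measurable b) (hw : Measurable w) :
    ∫⁻ t : EuclideanSpace ℝ (Fin n), ENNReal.ofReal
        ((uIcc (a (projFirst t)) (b (projFirst t))).indicator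
          (fun _ => w (projFirst t)) (lastCoord t)) =
      ∫⁻ x, ENNReal.ofReal (w x) * ENNReal.ofReal |b x - a x| := by
  have hg : Measurable fun z : ℝ × EuclideanSpace ℝ (Fin (n - 1)) =>
      ENNReal.ofReal ((uIcc (a z.2) (b z.2)).indicator (fun _ => w z.2) z.1) :=
    (measurable_indicator_uIcc (ha.comp measurable_snd) (hb.comp measurable_snd)
      (hw.comp measurable_snd) measurable_fst).ennreal_ofReal
  rw [(measurePreserving_lastCoord_projFirst hn).lintegral_comp hg, lintegral_prod_symm' _ hg]
  refine lintegral_congr fun x => ?_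
  have : ∀ τ : ℝ, ENNReal.ofReal ((uIcc (a x) (b x)).indicator (fun _ => w x) τ) =
      (uIcc (a x) (b x)).indicator (fun _ => ENNReal.ofReal (w x)) τ := fun τ => by
    by_cases h : τ ∈ uIcc (a x) (b x) <;> simp [h]
  simp_rw [this]
  rw [lintegral_indicator measurableSet_uIcc, setLIntegral_const, Real.volume_interval]

lemma measurable_realSign : Measurable Real.sign := by
  unfold Real.sign
  exact Measurable.ite measurableSet_Iio measurable_const
    (Measurable.ite measurableSet_Ioi measurable_const measurable_const)

lemma integral_eq_zero_of_odd {E : Type*} [NormedAddCommGroup E] [MeasurableSpace E]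
    [BorelSpace E] {μ : Measure E} [μ.IsNegInvariant] {f : E → ℝ} (hf : ∀ x, f (-x) = -f x) :
    ∫ x, f x ∂μ = 0 := by
  have h := integral_neg_eq_self f μ
  simp_rw [hf, integral_neg] at h
  linarith

lemma nmcAt_eq_integral_translate (n : ℕ) (s : ℝ) {F : Set (EuclideanSpace ℝ (Fin n))}
    (p : EuclideanSpace ℝ (Fin n)) (ε : ℝ) :
    nmcAt n s F p ε = ∫ t, (Fᶜ.indicator (fun _ => (1 : ℝ)) (p + t) -
      F.indicator (fun _ => (1 : ℝ)) (p + t)) *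
        {t : EuclideanSpace ℝ (Fin n) | ε < ‖t‖}.indicator (fun t => ‖t‖ ^ (-((n : ℝ) + s))) t := by
  have hmeas : MeasurableSet {y : EuclideanSpace ℝ (Fin n) | ε < ‖y - p‖} :=
    measurableSet_lt measurable_const (by fun_prop)
  rw [nmcAt, ← integral_indicator hmeas, ← integral_add_left_eq_self _ p]
  refine integral_congr_ae (Eventually.of_forall fun t => ?_)
  by_cases ht : ε < ‖t‖
  · simp only [indicator, mem_ofPred_eq, ht, add_sub_cancel_left]
    rfl
  · simp [indicator, ht]

/-- At a graph point where `u` has a remainder of size `K * min (|t|²) |t|` after subtracting a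
linear map, the subgraph of `u` has a nonlocal mean curvature, bounded linearly in `K`: the
half-space below the linear map contributes nothing by oddness, and what is left is an absolutely
convergent integral over the region between the two graphs. -/
theorem exists_hasNMC_subgraph_le {n : ℕ} (hn : 2 ≤ n) {s : ℝ} (hs : s ∈ Ioo (0 : ℝ) 1)
    {u : EuclideanSpace ℝ (Fin (n - 1)) → ℝ} (hu : Continuous u)
    {p : EuclideanSpace ℝ (Fin n)} (hp : lastCoord p = u (projFirst p))
    (L : EuclideanSpace ℝ (Fin (n - 1)) →L[ℝ] ℝ) {K : ℝ} (hK : 0 ≤ K)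
    (hL : ∀ t, |u (projFirst p + t) - u (projFirst p) - L t| ≤ K * min (‖t‖ ^ 2) ‖t‖) :
    ∃ h : ℝ, HasNMC n s {x | lastCoord x < u (projFirst x)} p h ∧
      h ≤ 2 * K * ∫ x : EuclideanSpace ℝ (Fin (n - 1)),
        min (‖x‖ ^ 2) ‖x‖ * ‖x‖ ^ (-((n : ℝ) + s)) := by
  set F : Set (EuclideanSpace ℝ (Fin n)) := {x | lastCoord x < u (projFirst x)} with hF
  set r : ℝ := -((n : ℝ) + s) with hr
  have hr_neg : r < 0 := by have := hs.1; rw [hr, neg_lt_zero]; positivity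
  have hFmeas : MeasurableSet F :=
    (isOpen_lt continuous_lastCoord (hu.comp continuous_projFirst)).measurableSet
  let a : EuclideanSpace ℝ (Fin (n - 1)) → ℝ := fun x => u (projFirst p + x) - u (projFirst p)
  have ha : Measurable a := (by fun_prop : Continuous a).measurable
  have hLm : Measurable L := L.continuous.measurable
  let σ : EuclideanSpace ℝ (Fin n) → ℝ := fun t =>
    Fᶜ.indicator (fun _ => (1 : ℝ)) (p + t) - F.indicator (fun _ => (1 : ℝ)) (p + t)
  let ς : EuclideanSpace ℝ (Fin n) → ℝ := fun t => Real.sign (lastCoord t - L (projFirst t))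
  let k : ℝ → EuclideanSpace ℝ (Fin n) → ℝ := fun ε =>
    {t : EuclideanSpace ℝ (Fin n) | ε < ‖t‖}.indicator fun t => ‖t‖ ^ r
  let B : EuclideanSpace ℝ (Fin n) → ℝ := fun t => (uIcc (a (projFirst t)) (L (projFirst t))).indicator
    (fun _ => 2 * ‖projFirst t‖ ^ r) (lastCoord t)
  have hσ_ite : ∀ t, σ t = if lastCoord t < a (projFirst t) then -1 else 1 := by
    intro t
    have hiff : p + t ∈ F ↔ lastCoord t < a (projFirst t) := by
      simp only [hF, mem_ofPred_eq, lastCoord_add, projFirst_add, a, hp]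
      constructor <;> intro h <;> linarith
    by_cases h : p + t ∈ F
    · simp [σ, h, hiff.1 h]
    · simp [σ, h, mt hiff.2 h]
  have hσ_meas : Measurable σ :=
    ((measurable_const.indicator hFmeas.compl).comp (measurable_const_add p)).sub
      ((measurable_const.indicator hFmeas).comp (measurable_const_add p))
  have hς_meas : Measurable ς := measurable_realSign.comp
    (continuous_lastCoord.measurable.sub (hLm.comp continuous_projFirst.measurable))
  have hpow_meas : Measurable fun t : EuclideanSpace ℝ (Fin n) => ‖t‖ ^ r := measurable_norm.pow_const r
  have hB_meas : Measurable B := measurable_indicator_uIcc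
    (ha.comp continuous_projFirst.measurable) (hLm.comp continuous_projFirst.measurable)
    ((continuous_projFirst.measurable.norm.pow_const r).const_mul 2)
    continuous_lastCoord.measurable
  have hB_nonneg : ∀ t, 0 ≤ B t := fun t => indicator_nonneg (fun _ _ => by positivity) _
  have hbound : ∀ t, |(σ t - ς t) * ‖t‖ ^ r| ≤ B t := by
    intro t
    rw [abs_mul, hσ_ite, abs_of_nonneg (Real.rpow_nonneg (norm_nonneg t) r)]
    have h := abs_ite_sub_sign_le (a (projFirst t)) (L (projFirst t)) (lastCoord t)
    by_cases hτ : lastCoord t ∈ uIcc (a (projFirst t)) (L (projFirst t))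
    · rw [indicator_of_mem hτ] at h
      simp only [B, indicator_of_mem hτ]
      refine mul_le_mul h ?_ (by positivity) two_pos.le
      rcases (norm_nonneg (projFirst t)).eq_or_lt with h0 | h0
      · have hpr : projFirst t = 0 := norm_eq_zero.1 h0.symm
        have hl : lastCoord t = 0 := by simpa [hpr, a] using hτ
        have ht : t = 0 := by
          have := norm_sq_eq_projFirst_lastCoord t
          rw [hpr, hl] at this
          simpa using this
        rw [hpr, ht, norm_zero, norm_zero]
      · exact Real.rpow_le_rpow_of_nonpos h0 (norm_projFirst_le t) hr_neg.le
    · rw [indicator_of_notMem hτ] at h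
      simp only [B, indicator_of_notMem hτ]
      rw [le_antisymm h (abs_nonneg _), zero_mul]
  have hI : Integrable fun x : EuclideanSpace ℝ (Fin (n - 1)) =>
      min (‖x‖ ^ 2) ‖x‖ * ‖x‖ ^ r := by
    have h := integrable_min_norm_mul_rpow (d := n - 1) (by omega) hs
    have hcast : ((n - 1 : ℕ) : ℝ) + 1 = n := by
      rw [Nat.cast_sub (by omega)]; push_cast; ring
    rwa [hcast] at h
  have hB_lint : ∫⁻ t, ENNReal.ofReal (B t) ≤ ENNReal.ofReal (2 * K * ∫ x :
      EuclideanSpace ℝ (Fin (n - 1)), min (‖x‖ ^ 2) ‖x‖ * ‖x‖ ^ r) := by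
    rw [lintegral_indicator_uIcc (by omega) (w := fun x => 2 * ‖x‖ ^ r) ha hLm
      ((measurable_norm.pow_const r).const_mul 2), ← integral_const_mul,
      ofReal_integral_eq_lintegral_ofReal (hI.const_mul _)
        (Eventually.of_forall fun x => by positivity)]
    refine lintegral_mono fun x => ?_
    rw [← ENNReal.ofReal_mul (by positivity)]
    refine ENNReal.ofReal_le_ofReal ?_
    rw [abs_sub_comm]
    calc 2 * ‖x‖ ^ r * |a x - L x| ≤ 2 * ‖x‖ ^ r * (K * min (‖x‖ ^ 2) ‖x‖) := by
          gcongr; exact hL x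
      _ = _ := by ring
  have hB_int : Integrable B := by
    refine ⟨hB_meas.aestronglyMeasurable, ?_⟩
    rw [hasFiniteIntegral_iff_ofReal (Eventually.of_forall hB_nonneg)]
    exact hB_lint.trans_lt ENNReal.ofReal_lt_top
  have hk_meas : ∀ ε, Measurable (k ε) := fun ε =>
    hpow_meas.indicator (measurableSet_lt measurable_const measurable_norm)
  have hnmc : ∀ ε, 0 < ε → nmcAt n s F p ε = ∫ t, (σ t - ς t) * k ε t := by
    intro ε hε
    have hk : Integrable (k ε) := integrable_indicator_norm_rpow (by omega) hs.1 hε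
    have hσk : Integrable fun t => σ t * k ε t :=
      hk.bdd_mul hσ_meas.aestronglyMeasurable (c := 1) (Eventually.of_forall fun t => by
        rw [hσ_ite]; split_ifs <;> simp)
    have hςk : Integrable fun t => ς t * k ε t :=
      hk.bdd_mul hς_meas.aestronglyMeasurable (c := 1) (Eventually.of_forall fun t => by
        rcases Real.sign_apply_eq (lastCoord t - L (projFirst t)) with h | h | h <;>
          simp [ς, h])
    have hodd : ∫ t, ς t * k ε t = 0 := integral_eq_zero_of_odd fun t => by
      have h1 : ς (-t) = -ς t := by
        simp only [ς, lastCoord_neg, projFirst_neg, map_neg, ← Real.sign_neg]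
        congr 1; ring
      have h2 : k ε (-t) = k ε t := by simp [k, indicator]
      rw [h1, h2, neg_mul]
    simp_rw [sub_mul]
    rw [integral_sub hσk hςk, hodd, sub_zero, nmcAt_eq_integral_translate]
  refine ⟨∫ t, (σ t - ς t) * ‖t‖ ^ r, ?_, ?_⟩
  · have hlim : Tendsto (fun ε => ∫ t, (σ t - ς t) * k ε t) (nhdsWithin 0 (Ioi 0))
        (nhds (∫ t, (σ t - ς t) * ‖t‖ ^ r)) := by
      refine tendsto_integral_filter_of_dominated_convergence B
        (Eventually.of_forall fun ε =>
          ((hσ_meas.sub hς_meas).mul (hk_meas ε)).aestronglyMeasurable)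
        (Eventually.of_forall fun ε => Eventually.of_forall fun t => ?_) hB_int
        (Eventually.of_forall fun t => ?_)
      · by_cases ht : ε < ‖t‖
        · simpa [k, ht] using hbound t
        · simpa [k, ht] using hB_nonneg t
      · refine Tendsto.const_mul _ (tendsto_const_nhds.congr' ?_)
        rcases (norm_nonneg t).eq_or_lt with h0 | h0
        · filter_upwards [self_mem_nhdsWithin] with ε hε
          have hε : 0 < ε := hε
          simp [k, ← h0, hε.not_gt, Real.zero_rpow hr_neg.ne]
        · filter_upwards [nhdsWithin_le_nhds (Iio_mem_nhds h0)] with ε hε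
          have hε : ε < ‖t‖ := hε
          simp [k, hε]
    refine hlim.congr' ?_
    filter_upwards [self_mem_nhdsWithin] with ε hε
    exact (hnmc ε hε).symm
  · calc ∫ t, (σ t - ς t) * ‖t‖ ^ r ≤ ∫ t, B t :=
          (Real.le_norm_self _).trans (norm_integral_le_of_norm_le hB_int
            (Eventually.of_forall hbound))
      _ ≤ _ := by
          rw [integral_eq_lintegral_of_nonneg_ae (Eventually.of_forall hB_nonneg)
            hB_meas.aestronglyMeasurable]
          refine ENNReal.toReal_le_of_le_ofReal ?_ hB_lint
          have : 0 ≤ ∫ x : EuclideanSpace ℝ (Fin (n - 1)), min (‖x‖ ^ 2) ‖x‖ * ‖x‖ ^ r :=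
            integral_nonneg fun x => by positivity
          positivity

/-- **Nonlocal mean curvature of a small smooth bump subgraph.**
Let `φ ∈ C_c^∞(ℝ^{n−1};[0,1])` with `φ = 1` on `{|x'| ≤ 1/2}` and `φ = 0` on `{|x'| ≥ 3/4}`,
and for `η > 0` let `F = {x_n < η φ(x')}`. Then there is `C₀ > 0`, depending only on `n`, `s`
and `φ`, such that for every `η > 0` and every `p ∈ ∂F` the nonlocal mean curvature
`H_s(F,p)` exists and satisfies `H_s(F,p) ≤ C₀ η`. -/
theorem bump_subgraph_nmc_upper_bound
    (n : ℕ) (hn : 2 ≤ n) (s : ℝ) (hs : s ∈ Set.Ioo (0 : ℝ) 1)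
    (φ : EuclideanSpace ℝ (Fin (n - 1)) → ℝ)
    (hφ_smooth : ContDiff ℝ (⊤ : ℕ∞) φ) (hφ_supp : HasCompactSupport φ)
    (hφ_range : ∀ x', φ x' ∈ Set.Icc (0 : ℝ) 1)
    (hφ_one : ∀ x', ‖x'‖ ≤ 1 / 2 → φ x' = 1)
    (hφ_zero : ∀ x', 3 / 4 ≤ ‖x'‖ → φ x' = 0) :
    ∃ C₀ : ℝ, 0 < C₀ ∧ ∀ η : ℝ, 0 < η →
      ∀ p ∈ frontier {x : EuclideanSpace ℝ (Fin n) | lastCoord x < η * φ (projFirst x)},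
        ∃ h : ℝ,
          HasNMC n s {x : EuclideanSpace ℝ (Fin n) | lastCoord x < η * φ (projFirst x)} p h ∧
          h ≤ C₀ * η := by
  obtain ⟨K, hK, hT⟩ := exists_norm_taylor_remainder_le
    (hφ_smooth.of_le (by exact WithTop.coe_le_coe.2 le_top)) hφ_supp
  set I : ℝ := ∫ x : EuclideanSpace ℝ (Fin (n - 1)),
    min (‖x‖ ^ 2) ‖x‖ * ‖x‖ ^ (-((n : ℝ) + s)) with hI
  have hI0 : 0 ≤ I := integral_nonneg fun x => by positivity
  refine ⟨2 * K * I + 1, by positivity, fun η hη p hp => ?_⟩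
  have hu : Continuous fun x' => η * φ x' := hφ_smooth.continuous.const_mul η
  have hp' := frontier_lt_subset_eq continuous_lastCoord (hu.comp continuous_projFirst) hp
  obtain ⟨h, hnmc, hle⟩ := exists_hasNMC_subgraph_le hn hs hu hp'
    (η • fderiv ℝ φ (projFirst p)) (K := η * K) (by positivity) fun t => by
      have h := hT (projFirst p) t
      rw [_root_.smul_apply, smul_eq_mul, ← mul_sub, ← mul_sub, abs_mul,
        abs_of_pos hη, mul_assoc]
      gcongr
  refine ⟨h, hnmc, hle.trans ?_⟩
  rw [← hI]
  nlinarith
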